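/- Let L ≥ 1, λ_1, …, λ_L > 0 and s_1, …, s_L > 0. Let DE denote the CDF of the standard Laplace distribution, DE^{−1} its inverse (quantile) function on (0,1), and DE_L the CDF of the sum of L independent standard Laplace random variables. (a) If for each j the sequence (u_{j,n})_{n≥1} ⊆ (0,1) satisfies −(1/n) log u_{j,n} → λ_j s_j as n → ∞, then −(1/n) · log DE_L(Σ_{j=1}^L DE^{−1}(u_{j,n})) → Σ_{j=1}^L λ_j s_j. (b) If instead −(1/n) log(1 − u_{j,n}) → λ_j s_j for each j, then −(1/n) · log(1 − DE_L(Σ_{j=1}^L DE^{−1}(u_{j,n}))) → Σ_{j=1}^L λ_j s_j. -/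

import Mathlib

open MeasureTheory Set Filter

/-- The standard double exponential (Laplace) distribution: the measure on `ℝ`
with Lebesgue density `(1/2) e^{-|t|}`. -/
noncomputable def laplaceMeasure : Measure ℝ :=
  volume.withDensity fun t => ENNReal.ofReal ((1/2) * Real.exp (-|t|))

/-- `DEL L t` is the CDF, evaluated at `t`, of the sum of `L` independent standard
Laplace random variables (the `L`-fold convolution `DE ∗ ⋯ ∗ DE`). -/
noncomputable def DEL (L : ℕ) (t : ℝ) : ℝ :=
  ((Measure.pi fun _ : Fin L => laplaceMeasure) {x | ∑ i, x i ≤ t}).toReal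

/-- The quantile function `DE⁻¹` of the standard Laplace distribution on `(0,1)`:
`DE⁻¹(u) = log(2u)` for `u ≤ 1/2` and `DE⁻¹(u) = -log(2(1-u))` for `u ≥ 1/2`. -/
noncomputable def DEinv (u : ℝ) : ℝ :=
  if u ≤ 1/2 then Real.log (2 * u) else -Real.log (2 * (1 - u))

lemma integrable_exp_neg_mul_abs {c : ℝ} (hc : 0 < c) :
    Integrable (fun x : ℝ => Real.exp (-c * |x|)) := by
  refine Integrable.of_integral_ne_zero ?_
  rw [integral_comp_abs (f := fun x => Real.exp (-c * x)),
    integral_exp_mul_Ioi (neg_lt_zero.mpr hc)]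
  simp [hc.ne']

instance : IsProbabilityMeasure laplaceMeasure where
  measure_univ := by
    have hint : Integrable (fun t : ℝ => (1/2) * Real.exp (-|t|)) := by
      simpa using! (integrable_exp_neg_mul_abs one_pos).const_mul (1/2)
    rw [laplaceMeasure, withDensity_apply _ MeasurableSet.univ, Measure.restrict_univ,
      ← ofReal_integral_eq_lintegral_ofReal hint (ae_of_all _ fun t => by positivity),
      integral_const_mul, integral_comp_abs (f := fun x => Real.exp (-x)),
      integral_exp_neg_Ioi_zero]
    norm_num

lemma measurePreserving_neg_laplaceMeasure :
    MeasurePreserving (fun x : ℝ => -x) laplaceMeasure laplaceMeasure := by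
  refine ⟨measurable_neg, Measure.ext fun A hA => ?_⟩
  rw [Measure.map_apply measurable_neg hA, laplaceMeasure,
    withDensity_apply _ (measurable_neg hA), withDensity_apply _ hA,
    ← (Measure.measurePreserving_neg (volume : Measure ℝ)).setLIntegral_comp_preimage hA
      (by fun_prop)]
  simp

lemma laplaceMeasure_Iic {t : ℝ} (ht : t ≤ 0) :
    laplaceMeasure (Iic t) = ENNReal.ofReal ((1/2) * Real.exp t) := by
  have hint : IntegrableOn (fun x : ℝ => (1/2) * Real.exp x) (Iic t) :=
    (integrableOn_exp_Iic t).const_mul _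
  rw [laplaceMeasure, withDensity_apply _ measurableSet_Iic, ← integral_exp_Iic t,
    ← integral_const_mul,
    ofReal_integral_eq_lintegral_ofReal hint (ae_of_all _ fun t => by positivity)]
  refine setLIntegral_congr_fun measurableSet_Iic fun x hx => ?_
  rw [abs_of_nonpos (le_trans hx ht), neg_neg]

lemma integrable_exp_mul_laplaceMeasure {θ : ℝ} (hθ : |θ| < 1) :
    Integrable (fun x => Real.exp (θ * x)) laplaceMeasure := by
  rw [laplaceMeasure, integrable_withDensity_iff (by fun_prop)
    (ae_of_all _ fun _ => ENNReal.ofReal_lt_top)]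
  refine ((integrable_exp_neg_mul_abs (sub_pos.mpr hθ)).const_mul (1/2)).mono'
    (by fun_prop) (ae_of_all _ fun x => ?_)
  have hle : θ * x ≤ |θ| * |x| := (le_abs_self _).trans (abs_mul θ x).le
  rw [ENNReal.toReal_ofReal (by positivity), Real.norm_of_nonneg (by positivity),
    mul_left_comm, ← Real.exp_add]
  gcongr
  linarith

lemma DEL_mono (L : ℕ) : Monotone (DEL L) := fun _ _ hst =>
  ENNReal.toReal_mono (measure_ne_top _ _) (measure_mono fun _ hx => le_trans hx hst)

/-- Lower bound on the left tail: all summands lie below `t / L`. -/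
lemma exp_le_DEL {L : ℕ} (hL : 1 ≤ L) {t : ℝ} (ht : t ≤ 0) :
    (1/2) ^ L * Real.exp t ≤ DEL L t := by
  have hL0 : (0 : ℝ) < L := by exact_mod_cast hL
  have hsub : Set.univ.pi (fun _ : Fin L => Iic (t / L)) ⊆ {x | ∑ i, x i ≤ t} := by
    intro x hx
    calc ∑ i, x i ≤ ∑ _i : Fin L, t / L := Finset.sum_le_sum fun i _ => hx i trivial
      _ = t := by simp; field_simp
  have hle := ENNReal.toReal_mono (measure_ne_top _ _)
    (measure_mono (μ := Measure.pi fun _ : Fin L => laplaceMeasure) hsub)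
  refine le_of_eq_of_le ?_ hle
  rw [Measure.pi_pi, laplaceMeasure_Iic (div_nonpos_of_nonpos_of_nonneg ht hL0.le),
    Finset.prod_const, ENNReal.toReal_pow, ENNReal.toReal_ofReal (by positivity), mul_pow,
    ← Real.exp_nat_mul, Finset.card_univ, Fintype.card_fin, mul_div_cancel₀ _ hL0.ne']

/-- Chernoff bound on the left tail. -/
lemma exists_DEL_le_exp_mul (L : ℕ) {θ : ℝ} (hθ0 : 0 ≤ θ) (hθ1 : θ < 1) :
    ∃ M : ℝ, ∀ t, DEL L t ≤ Real.exp (θ * t) * M := by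
  refine ⟨ProbabilityTheory.mgf (fun x : Fin L → ℝ => ∑ i, x i)
    (Measure.pi fun _ => laplaceMeasure) (-θ), fun t => ?_⟩
  have hint : Integrable (fun x : Fin L → ℝ => Real.exp (-θ * ∑ i, x i))
      (Measure.pi fun _ => laplaceMeasure) := by
    simp_rw [Finset.mul_sum, Real.exp_sum]
    exact Integrable.fintype_prod fun _ =>
      integrable_exp_mul_laplaceMeasure (by rwa [abs_neg, abs_of_nonneg hθ0])
  have h := ProbabilityTheory.measure_le_le_exp_mul_mgf t (neg_nonpos.mpr hθ0) hint
  rwa [neg_neg] at h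

lemma one_sub_DEL (L : ℕ) (t : ℝ) :
    1 - DEL L t = (Measure.pi fun _ : Fin L => laplaceMeasure).real {x | ∑ i, x i < -t} := by
  have hm : MeasurableSet {x : Fin L → ℝ | ∑ i, x i ≤ t} :=
    measurableSet_le (by fun_prop) (by fun_prop)
  have hm' : MeasurableSet {x : Fin L → ℝ | ∑ i, x i < -t} :=
    measurableSet_lt (by fun_prop) (by fun_prop)
  have hneg := measurePreserving_pi (fun _ : Fin L => laplaceMeasure) (fun _ => laplaceMeasure)
    fun _ => measurePreserving_neg_laplaceMeasure
  rw [DEL, ← measureReal_def, ← probReal_compl_eq_one_sub hm, measureReal_def, measureReal_def,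
    ← hneg.measure_preimage hm'.nullMeasurableSet]
  congr 2
  ext x
  simp

lemma one_sub_DEL_le (L : ℕ) (t : ℝ) : 1 - DEL L t ≤ DEL L (-t) := by
  rw [one_sub_DEL]
  exact measureReal_mono fun x hx => (show ∑ i, x i < -t from hx).le

lemma DEL_le_one_sub_DEL (L : ℕ) (t : ℝ) : DEL L (-t - 1) ≤ 1 - DEL L t := by
  rw [one_sub_DEL]
  exact measureReal_mono fun x hx =>
    (show ∑ i, x i ≤ -t - 1 from hx).trans_lt (sub_one_lt _)

lemma tendsto_neg_one_div_mul_const (c : ℝ) :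
    Tendsto (fun n : ℕ => -(1/(n:ℝ)) * c) atTop (nhds 0) := by
  simpa using tendsto_one_div_atTop_nhds_zero_nat.neg.mul_const c

lemma eventually_lt_of_tendsto_neg_one_div_mul {T : ℕ → ℝ} {S : ℝ} (hS : 0 < S)
    (hT : Tendsto (fun n : ℕ => -(1/(n:ℝ)) * T n) atTop (nhds S)) (c : ℝ) :
    ∀ᶠ n in atTop, T n < c := by
  have h := hT.sub (tendsto_neg_one_div_mul_const c)
  rw [sub_zero] at h
  filter_upwards [h.eventually (lt_mem_nhds hS)] with n hn
  rw [← mul_sub] at hn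
  by_contra! hc
  exact hn.not_ge (mul_nonpos_of_nonpos_of_nonneg (by simp) (sub_nonneg.mpr hc))

lemma tendsto_log_DEL {L : ℕ} (hL : 1 ≤ L) {T : ℕ → ℝ} {S : ℝ} (hS : 0 < S)
    (hT : Tendsto (fun n : ℕ => -(1/(n:ℝ)) * T n) atTop (nhds S)) :
    Tendsto (fun n : ℕ => -(1/(n:ℝ)) * Real.log (DEL L (T n))) atTop (nhds S) := by
  have hneg := eventually_lt_of_tendsto_neg_one_div_mul hS hT 0
  have hcoef : ∀ n : ℕ, -(1/(n:ℝ)) ≤ 0 := fun n => by simp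
  refine tendsto_order.mpr ⟨fun a ha => ?_, fun a ha => ?_⟩
  · obtain ⟨θ, hθ, hθ1⟩ := exists_between (max_lt ((div_lt_one hS).mpr ha) one_pos)
    obtain ⟨hθa, hθ0⟩ := max_lt_iff.mp hθ
    obtain ⟨M, hM⟩ := exists_DEL_le_exp_mul L hθ0.le hθ1
    have hlim := (hT.const_mul θ).add (tendsto_neg_one_div_mul_const (Real.log M))
    rw [add_zero] at hlim
    filter_upwards [hneg, hlim.eventually (lt_mem_nhds ((div_lt_iff₀ hS).mp hθa))]
      with n hn hlt
    have hpos : 0 < DEL L (T n) := lt_of_lt_of_le (by positivity) (exp_le_DEL hL hn.le)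
    have hM0 : 0 < M := (pos_iff_pos_of_mul_pos (hpos.trans_le (hM _))).mp (Real.exp_pos _)
    have hlog := Real.log_le_log hpos (hM (T n))
    rw [Real.log_mul (Real.exp_pos _).ne' hM0.ne', Real.log_exp] at hlog
    have := mul_le_mul_of_nonpos_left hlog (hcoef n)
    linarith
  · have hlim := hT.add (tendsto_neg_one_div_mul_const (Real.log ((1/2) ^ L)))
    rw [add_zero] at hlim
    filter_upwards [hneg, hlim.eventually (gt_mem_nhds ha)] with n hn hlt
    have hlog := Real.log_le_log (by positivity) (exp_le_DEL hL hn.le)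
    rw [Real.log_mul (by positivity) (by positivity), Real.log_exp] at hlog
    have := mul_le_mul_of_nonpos_left hlog (hcoef n)
    linarith

lemma tendsto_log_one_sub_DEL {L : ℕ} (hL : 1 ≤ L) {T : ℕ → ℝ} {S : ℝ} (hS : 0 < S)
    (hT : Tendsto (fun n : ℕ => -(1/(n:ℝ)) * -T n) atTop (nhds S)) :
    Tendsto (fun n : ℕ => -(1/(n:ℝ)) * Real.log (1 - DEL L (T n))) atTop (nhds S) := by
  have hcoef : ∀ n : ℕ, -(1/(n:ℝ)) ≤ 0 := fun n => by simp
  have hT' : Tendsto (fun n : ℕ => -(1/(n:ℝ)) * (-T n - 1)) atTop (nhds S) := by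
    simpa [mul_sub] using hT.sub (tendsto_neg_one_div_mul_const 1)
  have hpos : ∀ᶠ n in atTop, 0 < DEL L (-T n - 1) := by
    filter_upwards [eventually_lt_of_tendsto_neg_one_div_mul hS hT' 0] with n hn
    exact lt_of_lt_of_le (by positivity) (exp_le_DEL hL hn.le)
  refine tendsto_of_tendsto_of_tendsto_of_le_of_le' (tendsto_log_DEL hL hS hT)
    (tendsto_log_DEL hL hS hT') ?_ ?_
  · filter_upwards [hpos] with n hn
    exact mul_le_mul_of_nonpos_left
      (Real.log_le_log (hn.trans_le (DEL_le_one_sub_DEL L _)) (one_sub_DEL_le L _)) (hcoef n)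
  · filter_upwards [hpos] with n hn
    exact mul_le_mul_of_nonpos_left (Real.log_le_log hn (DEL_le_one_sub_DEL L _)) (hcoef n)

lemma DEinv_one_sub (u : ℝ) : DEinv (1 - u) = -DEinv u := by
  rcases lt_trichotomy u (1/2) with h | rfl | h
  · rw [DEinv, DEinv, if_neg (by linarith), if_pos h.le, sub_sub_cancel]
  · norm_num [DEinv]
  · rw [DEinv, DEinv, if_pos (by linarith), if_neg (by linarith), neg_neg]

lemma tendsto_DEinv {v : ℕ → ℝ} {c : ℝ} (hc : 0 < c) (hv : ∀ n, 0 < v n)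
    (h : Tendsto (fun n : ℕ => -(1/(n:ℝ)) * Real.log (v n)) atTop (nhds c)) :
    Tendsto (fun n : ℕ => -(1/(n:ℝ)) * DEinv (v n)) atTop (nhds c) := by
  have hlim := (tendsto_neg_one_div_mul_const (Real.log 2)).add h
  rw [zero_add] at hlim
  refine hlim.congr' ?_
  filter_upwards [eventually_lt_of_tendsto_neg_one_div_mul hc h (Real.log (1/2))] with n hn
  have hle : v n ≤ 1/2 := ((Real.log_lt_log_iff (hv n) (by norm_num)).mp hn).le
  rw [DEinv, if_pos hle, Real.log_mul two_ne_zero (hv n).ne', mul_add]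

/-- **Theorem 3.2 (slope attainment for the double-exponential combination).**
(a) If `-(1/n) log u_{j,n} → λ_j s_j` for each `j`, then
`-(1/n) log DE_L(∑_j DE⁻¹(u_{j,n})) → ∑_j λ_j s_j`.
(b) If `-(1/n) log (1 - u_{j,n}) → λ_j s_j` for each `j`, then
`-(1/n) log (1 - DE_L(∑_j DE⁻¹(u_{j,n}))) → ∑_j λ_j s_j`. -/
theorem laplace_combination_slope
    (L : ℕ) (hL : 1 ≤ L) (lam s : Fin L → ℝ)
    (hlam : ∀ j, 0 < lam j) (hs : ∀ j, 0 < s j)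
    (u : Fin L → ℕ → ℝ) (hu : ∀ j n, u j n ∈ Ioo (0:ℝ) 1) :
    ((∀ j, Tendsto (fun n : ℕ => -(1/(n:ℝ)) * Real.log (u j n))
        atTop (nhds (lam j * s j))) →
      Tendsto (fun n : ℕ =>
          -(1/(n:ℝ)) * Real.log (DEL L (∑ j, DEinv (u j n))))
        atTop (nhds (∑ j, lam j * s j)))
    ∧
    ((∀ j, Tendsto (fun n : ℕ => -(1/(n:ℝ)) * Real.log (1 - u j n))
        atTop (nhds (lam j * s j))) →
      Tendsto (fun n : ℕ =>
          -(1/(n:ℝ)) * Real.log (1 - DEL L (∑ j, DEinv (u j n))))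
        atTop (nhds (∑ j, lam j * s j))) := by
  have : Nonempty (Fin L) := ⟨⟨0, hL⟩⟩
  have hc : ∀ j, 0 < lam j * s j := fun j => mul_pos (hlam j) (hs j)
  have hS : 0 < ∑ j, lam j * s j :=
    Finset.sum_pos (fun j _ => hc j) Finset.univ_nonempty
  refine ⟨fun h => tendsto_log_DEL hL hS ?_, fun h => tendsto_log_one_sub_DEL hL hS ?_⟩
  · simp_rw [Finset.mul_sum]
    exact tendsto_finsetSum _ fun j _ => tendsto_DEinv (hc j) (fun n => (hu j n).1) (h j)
  · simp_rw [← Finset.sum_neg_distrib, ← DEinv_one_sub, Finset.mul_sum]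
    exact tendsto_finsetSum _ fun j _ =>
      tendsto_DEinv (hc j) (fun n => sub_pos.mpr (hu j n).2) (h j)
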